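/- arXiv:2102.00597 — 3 statements merged into one kernel-verified Lean document; each statement's English description precedes it below -/
import Mathlib

section
/- Let C be a nontrivial linear code of length n over GF(q). Then: (i) there exists an integer w with 2 ≤ w ≤ n such that C⊥ contains a codeword of Hamming weight exactly w and every coordinate i ∈ [n] lies in the support of some nonzero codeword of C⊥ of Hamming weight at most w; (ii) moreover, if w is the smallest integer with these two properties, then the minimum linear locality of C equals w − 1. In particular, every nontrivial linear code has a minimum linear locality. -/
open scoped BigOperators

variable {F : Type*} [Field F] {ι : Type*} [Fintype ι]

/-- The Hamming weight of a word: the number of nonzero coordinates. -/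
noncomputable def wt (c : ι → F) : ℕ := {i | c i ≠ 0}.ncard

/-- The minimum distance of a linear code: the least Hamming weight of a nonzero codeword. -/
noncomputable def minDist (C : Submodule F (ι → F)) : ℕ :=
  sInf {w | ∃ c ∈ C, c ≠ 0 ∧ wt c = w}

/-- The dual code of a linear code. -/
def dualCode (C : Submodule F (ι → F)) : Submodule F (ι → F) where
  carrier := {x | ∀ c ∈ C, ∑ i, x i * c i = 0}
  add_mem' := by
    intro a b ha hb c hc
    have h1 := ha c hc
    have h2 := hb c hc
    simp only [Set.mem_setOf_eq, Pi.add_apply, add_mul, Finset.sum_add_distrib, h1, h2, add_zero]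
  zero_mem' := by intro c hc; simp
  smul_mem' := by
    intro r a ha c hc
    have h := ha c hc
    simp only [Set.mem_setOf_eq, Pi.smul_apply, smul_eq_mul, mul_assoc, ← Finset.mul_sum, h,
      mul_zero]

/-- `C` has linear locality `r`: every code symbol `c i` is a fixed linear combination of
at most `r` other code symbols. -/
def HasLinearLocality (C : Submodule F (ι → F)) (r : ℕ) : Prop :=
  ∀ i : ι, ∃ (R : Finset ι) (u : ι → F), i ∉ R ∧ R.card ≤ r ∧
    ∀ c ∈ C, c i = ∑ j ∈ R, u j * c j

lemma wt_eq_card [DecidableEq F] (c : ι → F) :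
    wt c = (Finset.univ.filter fun i => c i ≠ 0).card := by
  rw [wt, ← Set.ncard_coe_finset]
  congr 1
  ext i
  simp

lemma wt_le_card (c : ι → F) : wt c ≤ Fintype.card ι := by
  classical
  rw [wt_eq_card]
  exact Finset.card_le_univ _

omit [Fintype ι] in
lemma minDist_le_wt {C : Submodule F (ι → F)} {c : ι → F} (hc : c ∈ C) (h0 : c ≠ 0) :
    minDist C ≤ wt c :=
  Nat.sInf_le ⟨c, hc, h0, rfl⟩

omit [Fintype ι] in
/-- A code of positive minimum distance contains a nonzero word. -/
lemma exists_ne_zero_of_minDist_pos {C : Submodule F (ι → F)} (h : 0 < minDist C) :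
    ∃ c ∈ C, c ≠ 0 := by
  obtain ⟨_, c, hc, h0, _⟩ := Nat.nonempty_of_pos_sInf h
  exact ⟨c, hc, h0⟩

/-- If no word of weight one lies in `C`, the dual code is supported on every coordinate. -/
lemma exists_mem_dualCode_apply_ne_zero {C : Submodule F (ι → F)} (h : 2 ≤ minDist C) (i : ι) :
    ∃ x ∈ dualCode C, x i ≠ 0 := by
  classical
  have hi : Pi.single i (1 : F) ∉ C := fun hmem => by
    have h1 := minDist_le_wt hmem (by simp)
    have h2 : wt (Pi.single i (1 : F)) = 1 := by
      rw [wt, Set.ncard_eq_one]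
      exact ⟨i, by ext j; simp [Pi.single_apply]⟩
    omega
  obtain ⟨f, hf, hle⟩ := Submodule.exists_le_ker_of_notMem hi
  refine ⟨fun j => f (Pi.single j 1), fun c hc => ?_, hf⟩
  have hfc : f c = 0 := hle hc
  rw [LinearMap.pi_apply_eq_sum_univ f c] at hfc
  rw [← hfc]
  refine Finset.sum_congr rfl fun j _ => ?_
  rw [smul_eq_mul, mul_comm]
  refine congrArg (c j * f ·) (funext fun k => ?_)
  simp [Pi.single_apply, eq_comm]

omit [Fintype ι] in
/-- If the words of `D` of weight at most `t` cover all coordinates, then so do those of weight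
at most `w`, for some `w ≤ t` that is itself the weight of a nonzero word of `D`. -/
lemma exists_attained_weight_of_cover [Nonempty ι] {D : Submodule F (ι → F)} {t : ℕ}
    (h : ∀ i, ∃ c ∈ D, wt c ≤ t ∧ c i ≠ 0) :
    ∃ w ≤ t, (∃ c ∈ D, c ≠ 0 ∧ wt c = w) ∧
      ∀ i, ∃ c ∈ D, c ≠ 0 ∧ wt c ≤ w ∧ c i ≠ 0 := by
  have ne_zero {c : ι → F} {i : ι} (hi : c i ≠ 0) : c ≠ 0 := fun h0 => hi (by simp [h0])
  let S : Set ℕ := {w | w ≤ t ∧ ∃ c ∈ D, c ≠ 0 ∧ wt c = w}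
  have hbdd : BddAbove S := ⟨t, fun w hw => hw.1⟩
  have hne : S.Nonempty := by
    obtain ⟨c, hc, hct, hi⟩ := h (Classical.arbitrary ι)
    exact ⟨wt c, hct, c, hc, ne_zero hi, rfl⟩
  obtain ⟨hle, hatt⟩ := Nat.sSup_mem hne hbdd
  refine ⟨sSup S, hle, hatt, fun i => ?_⟩
  obtain ⟨c, hc, hct, hi⟩ := h i
  exact ⟨c, hc, ne_zero hi, le_csSup hbdd ⟨hct, c, hc, ne_zero hi, rfl⟩, hi⟩

/-- A dual word whose support contains `i` recovers the coordinate `i`. -/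
lemma exists_recovery_of_mem_dualCode {C : Submodule F (ι → F)} {x : ι → F}
    (hx : x ∈ dualCode C) {i : ι} (hi : x i ≠ 0) :
    ∃ (R : Finset ι) (u : ι → F), i ∉ R ∧ R.card ≤ wt x - 1 ∧
      ∀ c ∈ C, c i = ∑ j ∈ R, u j * c j := by
  classical
  refine ⟨(Finset.univ.filter fun j => x j ≠ 0).erase i, fun j => -(x i)⁻¹ * x j,
    Finset.notMem_erase _ _, ?_, fun c hc => ?_⟩
  · rw [Finset.card_erase_of_mem (by simp [hi]), ← wt_eq_card]
  · have hsum : ∑ j ∈ Finset.univ.filter (fun j => x j ≠ 0), x j * c j = 0 := by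
      rw [Finset.sum_filter_of_ne fun j _ hj => left_ne_zero_of_mul hj]
      exact hx c hc
    rw [← Finset.add_sum_erase _ _ (show i ∈ _ by simp [hi])] at hsum
    simp_rw [mul_assoc, ← Finset.mul_sum]
    rw [eq_neg_of_add_eq_zero_right hsum]
    field_simp

/-- A recovery rule for the coordinate `i` from the set `R` gives a dual word supported on
`insert i R`. -/
lemma exists_mem_dualCode_of_recovery {C : Submodule F (ι → F)} {i : ι} {R : Finset ι} {u : ι → F}
    (hi : i ∉ R) (h : ∀ c ∈ C, c i = ∑ j ∈ R, u j * c j) :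
    ∃ x ∈ dualCode C, wt x ≤ R.card + 1 ∧ x i ≠ 0 := by
  classical
  refine ⟨fun j => (if j = i then 1 else 0) - if j ∈ R then u j else 0, fun c hc => ?_, ?_, ?_⟩
  · simp [sub_mul, ite_mul, Finset.sum_sub_distrib, h c hc]
  · rw [wt_eq_card, ← Finset.card_insert_of_notMem hi]
    refine Finset.card_le_card fun j hj => ?_
    by_contra hn
    simp only [Finset.mem_insert, not_or] at hn
    simp [hn.1, hn.2] at hj
  · simp [hi]

/-- For a nontrivial linear code `C` of length `n`: (i) there is an integer
`w` with `2 ≤ w ≤ n` such that the dual code has a codeword of weight exactly `w` and every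
coordinate lies in the support of some nonzero dual codeword of weight at most `w`; (ii) if `w`
is the smallest integer with these two properties, then the minimum linear locality of `C`
equals `w - 1`. -/
theorem statement0 (C : Submodule F (ι → F))
    (hC : 2 ≤ minDist C ∧ 2 ≤ minDist (dualCode C)) :
    (∃ w : ℕ, 2 ≤ w ∧ w ≤ Fintype.card ι ∧
      (∃ c ∈ dualCode C, c ≠ 0 ∧ wt c = w) ∧
      (∀ i : ι, ∃ c ∈ dualCode C, c ≠ 0 ∧ wt c ≤ w ∧ c i ≠ 0)) ∧
    (∀ w : ℕ, IsLeast {w' : ℕ | (∃ c ∈ dualCode C, c ≠ 0 ∧ wt c = w') ∧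
        (∀ i : ι, ∃ c ∈ dualCode C, c ≠ 0 ∧ wt c ≤ w' ∧ c i ≠ 0)} w →
      IsLeast {r : ℕ | HasLinearLocality C r} (w - 1)) := by
  obtain ⟨hC1, hC2⟩ := hC
  obtain ⟨y, hy, hy0⟩ := exists_ne_zero_of_minDist_pos (by omega : 0 < minDist (dualCode C))
  obtain ⟨i₀, -⟩ := Function.ne_iff.mp hy0
  have : Nonempty ι := ⟨i₀⟩
  refine ⟨?_, fun w hw => ⟨fun i => ?_, fun r hr => ?_⟩⟩
  · obtain ⟨w, hwn, ⟨c, hc, hc0, hcw⟩, hcov⟩ :=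
      exists_attained_weight_of_cover (D := dualCode C) (t := Fintype.card ι) fun i =>
        let ⟨x, hx, hxi⟩ := exists_mem_dualCode_apply_ne_zero hC1 i
        ⟨x, hx, wt_le_card x, hxi⟩
    exact ⟨w, hcw ▸ hC2.trans (minDist_le_wt hc hc0), hwn, ⟨c, hc, hc0, hcw⟩, hcov⟩
  · obtain ⟨x, hx, -, hxw, hxi⟩ := hw.1.2 i
    obtain ⟨R, u, hiR, hR, hu⟩ := exists_recovery_of_mem_dualCode hx hxi
    exact ⟨R, u, hiR, by omega, hu⟩
  · obtain ⟨w', hw'r, hw'⟩ :=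
      exists_attained_weight_of_cover (D := dualCode C) (t := r + 1) fun i =>
        let ⟨_, _, hiR, hR, hu⟩ := hr i
        let ⟨x, hx, hxw, hxi⟩ := exists_mem_dualCode_of_recovery hiR hu
        ⟨x, hx, by omega, hxi⟩
    have := hw.2 hw'
    omega
end

section
/- Let q be a prime power, m ≥ 2 an integer, and n = (q^m − 1)/(q − 1) ≥ 4. Let C be any [n, n − m, 3] linear code over GF(q) (a q-ary Hamming code), let S = C⊥ (the q-ary Simplex code), and let t ∈ [n] be any coordinate. Then: (i) the shortened code C_t is an [n − 1, n − m − 1, 3] code with minimum linear locality q^{m−1} − 2; (ii) the dual (C_t)⊥ is an [n − 1, m, q^{m−1} − 1] code with minimum linear locality 2; (iii) the shortened code S_t is an [n − 1, m − 1, q^{m−1}] code with minimum linear locality 1; (iv) the dual (S_t)⊥ is an [n − 1, n − m, 2] code with minimum linear locality q^{m−1} − 1. -/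
open scoped BigOperators

variable {F : Type*} [Field F] {ι : Type*} [Fintype ι]

/-- The shortened code of a code `C` of length `n + 1` at coordinate `t`: take the codewords
vanishing at `t` and delete the coordinate `t`. -/
def shortenedCode {n : ℕ} (C : Submodule F (Fin (n + 1) → F)) (t : Fin (n + 1)) :
    Submodule F (Fin n → F) where
  carrier := {y | ∃ c ∈ C, c t = 0 ∧ ∀ i : Fin n, y i = c (t.succAbove i)}
  add_mem' := by
    rintro x y ⟨c, hc, hct, hcx⟩ ⟨e, he, het, hey⟩
    exact ⟨c + e, C.add_mem hc he, by simp [hct, het], fun i => by simp [hcx i, hey i]⟩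
  zero_mem' := ⟨0, C.zero_mem, rfl, fun i => rfl⟩
  smul_mem' := by
    rintro r x ⟨c, hc, hct, hcx⟩
    exact ⟨r • c, C.smul_mem r hc, by simp [hct], fun i => by simp [hcx i]⟩

theorem mem_dualCode {C : Submodule F (ι → F)} {x : ι → F} :
    x ∈ dualCode C ↔ ∀ c ∈ C, ∑ i, x i * c i = 0 := Iff.rfl

theorem mem_shortenedCode {F : Type*} [Field F] {n : ℕ} {C : Submodule F (Fin (n + 1) → F)}
    {t : Fin (n + 1)} {y : Fin n → F} :
    y ∈ shortenedCode C t ↔ ∃ c ∈ C, c t = 0 ∧ ∀ i : Fin n, y i = c (t.succAbove i) := Iff.rfl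

theorem dualCode_eq_orthogonal [DecidableEq ι] (C : Submodule F (ι → F)) :
    dualCode C = (Matrix.toBilin' (1 : Matrix ι ι F)).orthogonal C := by
  ext x
  simp [mem_dualCode, LinearMap.BilinForm.mem_orthogonal_iff,
    Matrix.toBilin'_apply', dotProduct, mul_comm]

theorem finrank_dualCode (C : Submodule F (ι → F)) :
    Module.finrank F (dualCode C) = Fintype.card ι - Module.finrank F C := by
  classical
  rw [dualCode_eq_orthogonal, LinearMap.BilinForm.finrank_orthogonal, Module.finrank_fintype_fun_eq_card]
  exact Matrix.nondegenerate_toBilin'_iff.2 (Matrix.nondegenerate_of_det_ne_zero (by simp))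

theorem dualCode_dualCode (C : Submodule F (ι → F)) : dualCode (dualCode C) = C := by
  classical
  rw [dualCode_eq_orthogonal, dualCode_eq_orthogonal, LinearMap.BilinForm.orthogonal_orthogonal]
  · exact Matrix.nondegenerate_toBilin'_iff.2 (Matrix.nondegenerate_of_det_ne_zero (by simp))
  · intro x y h
    simpa [Matrix.toBilin'_apply', dotProduct, mul_comm] using h

theorem wt_eq_sum [DecidableEq F] (c : ι → F) : wt c = ∑ i, if c i ≠ 0 then 1 else 0 := by
  rw [wt, Set.ncard_eq_toFinset_card', Finset.sum_boole]
  simp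

theorem wt_comp_succAbove {F : Type*} [Field F] [DecidableEq F] {n : ℕ} (t : Fin (n + 1))
    (x : Fin (n + 1) → F) :
    wt x = (if x t ≠ 0 then 1 else 0) + wt (fun i => x (t.succAbove i)) := by
  rw [wt_eq_sum, wt_eq_sum, Fin.sum_univ_succAbove _ t]

omit [Fintype ι] in
theorem wt_le_card_of_forall_notMem {c : ι → F} (s : Finset ι) (h : ∀ i ∉ s, c i = 0) :
    wt c ≤ s.card := by
  rw [← Set.ncard_coe_finset]
  refine Set.ncard_le_ncard (fun i hi => ?_) s.finite_toSet
  by_contra hs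
  exact hi (h i hs)

/-- A repair rule for the coordinate `i` reading at most `r` symbols amounts to a dual word of
weight at most `r + 1` that is nonzero at `i`. -/
theorem hasLinearLocality_iff {C : Submodule F (ι → F)} {r : ℕ} :
    HasLinearLocality C r ↔ ∀ i, ∃ y ∈ dualCode C, y i ≠ 0 ∧ wt y ≤ r + 1 := by
  classical
  refine forall_congr' fun i => ⟨?_, ?_⟩
  · rintro ⟨R, u, hi, hR, h⟩
    refine ⟨fun j => if j = i then 1 else if j ∈ R then - u j else 0, ?_, by simp, ?_⟩
    · intro c hc
      have : ∀ j, (if j = i then 1 else if j ∈ R then - u j else 0) * c j =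
          (if j = i then c j else 0) - (if j ∈ R then u j * c j else 0) := by
        intro j
        by_cases hj : j = i
        · subst hj; simp [hi]
        · by_cases hj' : j ∈ R <;> simp [hj, hj']
      simp only [this, Finset.sum_sub_distrib]
      simp [h c hc]
    · refine (wt_le_card_of_forall_notMem (insert i R) ?_).trans ?_
      · intro j hj
        rw [Finset.mem_insert, not_or] at hj
        simp [hj.1, hj.2]
      · exact (Finset.card_insert_le _ _).trans (by omega)
  · rintro ⟨y, hy, hyi, hw⟩
    refine ⟨(Finset.univ.filter fun j => y j ≠ 0).erase i, fun j => - y j / y i, by simp, ?_, ?_⟩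
    · rw [Finset.card_erase_of_mem (by simpa using hyi)]
      rw [wt_eq_sum, Finset.sum_boole] at hw
      simp only [Nat.cast_id] at hw
      omega
    · intro c hc
      have h := hy c hc
      rw [← Finset.sum_filter_add_sum_filter_not Finset.univ (fun j => y j ≠ 0),
        Finset.sum_eq_zero (s := Finset.univ.filter fun j => ¬ y j ≠ 0), add_zero,
        ← Finset.add_sum_erase _ _ (a := i) (by simpa using hyi)] at h
      · have : ∀ j, - y j / y i * c j = - (y i)⁻¹ * (y j * c j) := fun j => by ring
        simp only [this, ← Finset.mul_sum]
        field_simp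
        linear_combination h
      · intro j hj
        simp only [Finset.mem_filter, not_not] at hj
        simp [hj.2]

/-- All nonzero words have weight at least `d`, and the words of weight at most `d` cover all
coordinates. -/
def IsCoveredByMinWeight (C : Submodule F (ι → F)) (d : ℕ) : Prop :=
  (∀ y ∈ C, y ≠ 0 → d ≤ wt y) ∧ ∀ i, ∃ y ∈ C, y i ≠ 0 ∧ wt y ≤ d

omit [Fintype ι] in
theorem IsCoveredByMinWeight.minDist_eq [Nonempty ι] {C : Submodule F (ι → F)} {d : ℕ}
    (h : IsCoveredByMinWeight C d) : minDist C = d := by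
  obtain ⟨y, hy, hyi, hw⟩ := h.2 (Classical.arbitrary ι)
  have hy0 : y ≠ 0 := fun h => hyi (by simp [h])
  refine IsLeast.csInf_eq ⟨⟨y, hy, hy0, hw.antisymm (h.1 y hy hy0)⟩, ?_⟩
  rintro w ⟨c, hc, hc0, rfl⟩
  exact h.1 c hc hc0

theorem IsCoveredByMinWeight.isLeast_locality_dualCode [Nonempty ι] {C : Submodule F (ι → F)}
    {d : ℕ} (h : IsCoveredByMinWeight C (d + 1)) :
    IsLeast {r : ℕ | HasLinearLocality (dualCode C) r} d := by
  constructor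
  · simpa only [Set.mem_ofPred_eq, hasLinearLocality_iff, dualCode_dualCode] using h.2
  · intro r hr
    simp only [Set.mem_ofPred_eq, hasLinearLocality_iff, dualCode_dualCode] at hr
    obtain ⟨y, hy, hyi, hw⟩ := hr (Classical.arbitrary ι)
    have := h.1 y hy (fun h => hyi (by simp [h]))
    omega

omit [Fintype ι] in
theorem le_wt_of_minDist_eq {C : Submodule F (ι → F)} {d : ℕ} (hd : minDist C = d) {c : ι → F}
    (hc : c ∈ C) (h0 : c ≠ 0) : d ≤ wt c :=
  hd ▸ Nat.sInf_le ⟨c, hc, h0, rfl⟩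

/-- The dual of the shortened code is the punctured dual code. -/
theorem mem_dualCode_shortenedCode {F : Type*} [Field F] {n : ℕ}
    {C : Submodule F (Fin (n + 1) → F)} {t : Fin (n + 1)} {y : Fin n → F} :
    y ∈ dualCode (shortenedCode C t) ↔ ∃ x ∈ dualCode C, y = fun i => x (t.succAbove i) := by
  let P := (dualCode C).map (LinearMap.funLeft F F t.succAbove)
  have hP : dualCode P = shortenedCode C t := by
    ext y
    rw [mem_dualCode, mem_shortenedCode]
    constructor
    · intro h
      refine ⟨t.insertNth 0 y, ?_, by simp, by simp⟩
      rw [← dualCode_dualCode C, mem_dualCode]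
      intro c hc
      simpa [Fin.sum_univ_succAbove _ t] using h _ (Submodule.mem_map_of_mem hc)
    · rintro ⟨c, hc, hct, hy⟩ z ⟨x, hx, rfl⟩
      have := hx c hc
      rw [Fin.sum_univ_succAbove _ t, hct, mul_zero, zero_add] at this
      simpa [hy, LinearMap.funLeft_apply, mul_comm] using this
  rw [← hP, dualCode_dualCode, Submodule.mem_map]
  exact exists_congr fun x => and_congr_right fun _ => eq_comm

theorem finrank_shortenedCode_add_one {F : Type*} [Field F] {n : ℕ}
    {C : Submodule F (Fin (n + 1) → F)} {t : Fin (n + 1)} (h : ∃ c ∈ C, c t ≠ 0) :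
    Module.finrank F (shortenedCode C t) + 1 = Module.finrank F C := by
  obtain ⟨c, hc, hct⟩ := h
  let f : Module.Dual F C := (LinearMap.proj t).comp C.subtype
  have hf : f ≠ 0 := fun h => hct (DFunLike.congr_fun h ⟨c, hc⟩)
  rw [← Module.Dual.finrank_ker_add_one_of_ne_zero hf]
  let g : LinearMap.ker f →ₗ[F] (Fin n → F) :=
    (LinearMap.funLeft F F t.succAbove).comp (C.subtype.comp (LinearMap.ker f).subtype)
  have hg : Function.Injective g := by
    rw [injective_iff_map_eq_zero]
    rintro ⟨⟨x, hx⟩, hxt⟩ h0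
    have hxt : x t = 0 := hxt
    ext i
    revert i
    rw [Fin.forall_iff_succAbove t]
    exact ⟨hxt, fun i => congrFun h0 i⟩
  have : LinearMap.range g = shortenedCode C t := by
    ext y
    rw [mem_shortenedCode]
    constructor
    · rintro ⟨⟨⟨x, hx⟩, hxt⟩, rfl⟩
      exact ⟨x, hx, hxt, fun i => rfl⟩
    · rintro ⟨x, hx, hxt, hy⟩
      exact ⟨⟨⟨x, hx⟩, hxt⟩, funext fun i => (hy i).symm⟩
  rw [← this, LinearMap.finrank_range_of_inj hg]

section Geometry

variable [DecidableEq ι] (C : Submodule F (ι → F))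

/-- The class of a unit vector modulo `C`: a column of a parity check matrix of `C`. -/
def parityColumn (i : ι) : (ι → F) ⧸ C := C.mkQ (Pi.single i 1)

theorem mkQ_eq_sum_parityColumn (c : ι → F) : C.mkQ c = ∑ i, c i • parityColumn C i := by
  conv_lhs => rw [pi_eq_sum_univ' c]
  simp [parityColumn, map_sum, Pi.single]

variable {C}

theorem exists_functional_of_mem_dualCode {x : ι → F} (hx : x ∈ dualCode C) :
    ∃ φ : Module.Dual F ((ι → F) ⧸ C), ∀ i, φ (parityColumn C i) = x i := by
  refine ⟨C.liftQ (∑ i, x i • LinearMap.proj i) fun c hc => ?_, fun i => ?_⟩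
  · simpa [LinearMap.sum_apply] using hx c hc
  · simp [parityColumn, LinearMap.sum_apply, Pi.single_apply]

theorem functional_mem_dualCode (φ : Module.Dual F ((ι → F) ⧸ C)) :
    (fun i => φ (parityColumn C i)) ∈ dualCode C := by
  intro c hc
  have h : φ (C.mkQ c) = 0 := by
    rw [Submodule.mkQ_apply, (Submodule.Quotient.mk_eq_zero C).2 hc, map_zero]
  rw [mkQ_eq_sum_parityColumn, map_sum] at h
  simpa [mul_comm] using h

variable (hd : ∀ c ∈ C, c ≠ 0 → 3 ≤ wt c)
include hd

omit [Fintype ι] in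
theorem eq_zero_of_smul_parityColumn_add {i j : ι} (hij : i ≠ j) {a b : F}
    (h : a • parityColumn C i + b • parityColumn C j = 0) : a = 0 ∧ b = 0 := by
  have hc : (Pi.single i a + Pi.single j b : ι → F) ∈ C := by
    rw [← Submodule.Quotient.mk_eq_zero C, ← h]
    simp only [parityColumn, ← map_smul, ← map_add, ← Pi.single_smul, smul_eq_mul, mul_one]
    rfl
  by_contra hab
  have h0 : (Pi.single i a + Pi.single j b : ι → F) ≠ 0 := by
    intro h0
    refine hab ⟨?_, ?_⟩
    · simpa [hij] using congrFun h0 i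
    · simpa [hij.symm] using congrFun h0 j
  have h2 := wt_le_card_of_forall_notMem (c := (Pi.single i a + Pi.single j b : ι → F)) {i, j} <| by
    intro k hk
    simp only [Finset.mem_insert, Finset.mem_singleton, not_or] at hk
    simp [hk.1, hk.2]
  have := hd _ hc h0
  have := Finset.card_le_two (a := i) (b := j)
  omega

theorem smul_parityColumn_ne_zero [Nontrivial ι] (i : ι) {a : F} (ha : a ≠ 0) :
    a • parityColumn C i ≠ 0 := by
  intro h
  obtain ⟨j, hj⟩ := exists_ne i
  exact ha (eq_zero_of_smul_parityColumn_add hd hj.symm (a := a) (b := 0) (by simpa using h)).1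

theorem exists_dual_eq_zero_ne_zero {i j : ι} (hij : i ≠ j) :
    ∃ x ∈ dualCode C, x i ≠ 0 ∧ x j = 0 := by
  have h : parityColumn C i ∉ Submodule.span F {parityColumn C j} := by
    rw [Submodule.mem_span_singleton]
    rintro ⟨a, ha⟩
    have := eq_zero_of_smul_parityColumn_add hd hij (a := -1) (b := a) (by simp [ha])
    simp at this
  obtain ⟨φ, hφ, hφ'⟩ := Submodule.exists_le_ker_of_notMem h
  refine ⟨_, functional_mem_dualCode φ, hφ, hφ' (Submodule.mem_span_singleton_self _)⟩

theorem exists_dual_ne_zero_ne_zero {i j : ι} (hij : i ≠ j) :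
    ∃ x ∈ dualCode C, x i ≠ 0 ∧ x j ≠ 0 := by
  obtain ⟨x, hx, hxi, hxj⟩ := exists_dual_eq_zero_ne_zero hd hij
  obtain ⟨y, hy, hyj, hyi⟩ := exists_dual_eq_zero_ne_zero hd hij.symm
  exact ⟨x + y, add_mem hx hy, by simpa [hyi], by simpa [hxj]⟩

variable [Fintype F] [Nontrivial ι] {q m : ℕ} (hq : Fintype.card F = q)
  (hW : Module.finrank F ((ι → F) ⧸ C) = m) (hn : Fintype.card ι * (q - 1) = q ^ m - 1)
include hq hW hn

theorem bijective_smul_parityColumn : Function.Bijective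
    (fun p : Fˣ × ι => (⟨(p.1 : F) • parityColumn C p.2,
      smul_parityColumn_ne_zero hd p.2 p.1.ne_zero⟩ : {w : (ι → F) ⧸ C // w ≠ 0})) := by
  classical
  have : Fintype ((ι → F) ⧸ C) := Fintype.ofFinite _
  rw [Fintype.bijective_iff_injective_and_card]
  constructor
  · rintro ⟨a, i⟩ ⟨b, j⟩ h
    have h : (a : F) • parityColumn C i = (b : F) • parityColumn C j := congrArg Subtype.val h
    by_cases hij : i = j
    · subst hij
      refine Prod.ext (Units.ext ?_) rfl
      by_contra hab
      exact smul_parityColumn_ne_zero hd i (sub_ne_zero.2 hab) (by rw [sub_smul, h, sub_self])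
    · exact absurd (eq_zero_of_smul_parityColumn_add hd hij (a := a) (b := -b) (by simp [h])).1
        a.ne_zero
  · rw [Fintype.card_prod, Fintype.card_units, Fintype.card_subtype_compl,
      Module.card_eq_pow_finrank (K := F) (V := (ι → F) ⧸ C), hW, hq]
    simpa [mul_comm] using hn

theorem wt_of_mem_dualCode {x : ι → F} (hx : x ∈ dualCode C) (h0 : x ≠ 0) :
    wt x = q ^ (m - 1) := by
  classical
  have : Fintype ((ι → F) ⧸ C) := Fintype.ofFinite _
  obtain ⟨φ, hφ⟩ := exists_functional_of_mem_dualCode hx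
  have hφ0 : φ ≠ 0 := by
    rintro rfl
    exact h0 (funext fun i => (hφ i).symm)
  have hbij := bijective_smul_parityColumn hd hq hW hn
  have hq2 : 2 ≤ q := hq ▸ Fintype.one_lt_card
  have e : Fintype.card (Fˣ × {i // x i ≠ 0}) = Fintype.card {w : (ι → F) ⧸ C // ¬ φ w = 0} := by
    refine Fintype.card_of_bijective (f := fun p => ⟨(p.1 : F) • parityColumn C p.2, by
      simpa [hφ] using p.2.2⟩) ⟨?_, ?_⟩
    · rintro ⟨a, i, hi⟩ ⟨b, j, hj⟩ h
      have h : (a : F) • parityColumn C i = (b : F) • parityColumn C j := congrArg Subtype.val h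
      have := hbij.1 (a₁ := (a, i)) (a₂ := (b, j)) (Subtype.ext h)
      simp_all
    · rintro ⟨w, hw⟩
      have hw0 : w ≠ 0 := by rintro rfl; simp at hw
      obtain ⟨⟨a, i⟩, h⟩ := hbij.2 ⟨w, hw0⟩
      have h : (a : F) • parityColumn C i = w := congrArg Subtype.val h
      refine ⟨⟨a, i, fun hi => hw ?_⟩, Subtype.ext h⟩
      rw [← h, map_smul, hφ, hi, smul_zero]
  have hker : Fintype.card {w : (ι → F) ⧸ C // φ w = 0} = q ^ (m - 1) := by
    have h1 := Module.Dual.finrank_ker_add_one_of_ne_zero hφ0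
    have h2 := Module.card_eq_pow_finrank (K := F) (V := LinearMap.ker φ)
    rw [hq, show Module.finrank F (LinearMap.ker φ) = m - 1 by omega] at h2
    rw [← h2]
    exact Fintype.card_congr (Equiv.refl _)
  have hm : m = (m - 1) + 1 := by
    have h1 := Module.Dual.finrank_ker_add_one_of_ne_zero hφ0
    omega
  have hwt : wt x = Fintype.card {i // x i ≠ 0} := by
    rw [wt_eq_sum, Finset.sum_boole, Fintype.card_subtype, Nat.cast_id]
  rw [Fintype.card_prod, Fintype.card_units, ← hwt, Fintype.card_subtype_compl, hker,
    Module.card_eq_pow_finrank (K := F) (V := (ι → F) ⧸ C), hW, hq,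
    show q ^ m - q ^ (m - 1) = (q - 1) * q ^ (m - 1) by
    conv_lhs => rw [hm, pow_succ]
    rw [Nat.sub_mul, one_mul, mul_comm]
    simp] at e
  exact Nat.eq_of_mul_eq_mul_left (by omega) e

/-- The third point on the line through two points. -/
theorem exists_third_point {i j : ι} (hij : i ≠ j) :
    ∃ k, k ≠ i ∧ k ≠ j ∧ ∃ c ∈ C, c i ≠ 0 ∧ c j ≠ 0 ∧ ∀ l, l ≠ i → l ≠ j → l ≠ k → c l = 0 := by
  have h0 : parityColumn C i + parityColumn C j ≠ 0 := fun h =>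
    one_ne_zero (eq_zero_of_smul_parityColumn_add hd hij (a := (1 : F)) (b := 1) (by simpa using h)).1
  obtain ⟨⟨a, k⟩, h⟩ := (bijective_smul_parityColumn hd hq hW hn).2 ⟨_, h0⟩
  have h : (a : F) • parityColumn C k = parityColumn C i + parityColumn C j :=
    congrArg Subtype.val h
  have hki : k ≠ i := by
    rintro rfl
    exact one_ne_zero (eq_zero_of_smul_parityColumn_add hd hij (a := 1 - (a : F)) (b := 1)
      (by rw [sub_smul, h]; simp)).2
  have hkj : k ≠ j := by
    rintro rfl
    exact one_ne_zero (eq_zero_of_smul_parityColumn_add hd hij (a := 1) (b := 1 - (a : F))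
      (by rw [sub_smul, h]; simp)).1
  refine ⟨k, hki, hkj, Pi.single i 1 + Pi.single j 1 - Pi.single k (a : F), ?_, ?_, ?_, ?_⟩
  · rw [← Submodule.Quotient.mk_eq_zero C]
    have : (Pi.single k (a : F) : ι → F) = (a : F) • Pi.single k 1 := by
      rw [← Pi.single_smul, smul_eq_mul, mul_one]
    rw [this]
    exact sub_eq_zero.2 h.symm
  · simp [hij, hki.symm]
  · simp [hij.symm, hkj.symm]
  · intro l hi hj hk
    simp [hi, hj, hk]

theorem exists_light_word_through {i t : ι} (hit : i ≠ t) :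
    ∃ c ∈ C, c i ≠ 0 ∧ c t ≠ 0 ∧ wt c ≤ 3 := by
  obtain ⟨k, -, -, c, hc, hi, ht, hl⟩ := exists_third_point hd hq hW hn hit
  refine ⟨c, hc, hi, ht, (wt_le_card_of_forall_notMem {i, t, k} fun l h => ?_).trans
    Finset.card_le_three⟩
  simp only [Finset.mem_insert, Finset.mem_singleton, not_or] at h
  exact hl l h.1 h.2.1 h.2.2

theorem exists_light_word_avoiding (h4 : 4 ≤ Fintype.card ι) {i t : ι} (hit : i ≠ t) :
    ∃ c ∈ C, c i ≠ 0 ∧ c t = 0 ∧ wt c ≤ 3 := by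
  have hex : ∀ s : Finset ι, s.card ≤ 3 → ∃ j, j ∉ s := by
    intro s hs
    obtain ⟨j, -, hj⟩ := Finset.exists_mem_notMem_of_card_lt_card (s := s) (t := Finset.univ)
      (by rw [Finset.card_univ]; omega)
    exact ⟨j, hj⟩
  have key : ∀ j, j ≠ i → j ≠ t → (∃ c ∈ C, c i ≠ 0 ∧ c t = 0 ∧ wt c ≤ 3) ∨
      ∃ c ∈ C, c i ≠ 0 ∧ c j ≠ 0 ∧ c t ≠ 0 ∧ ∀ l, l ≠ i → l ≠ j → l ≠ t → c l = 0 := by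
    intro j hji hjt
    obtain ⟨k, hki, hkj, c, hc, hi, hj, hl⟩ := exists_third_point hd hq hW hn hji.symm
    have hw : wt c ≤ 3 := (wt_le_card_of_forall_notMem {i, j, k} fun l h => by
      simp only [Finset.mem_insert, Finset.mem_singleton, not_or] at h
      exact hl l h.1 h.2.1 h.2.2).trans Finset.card_le_three
    by_cases ht : c t = 0
    · exact Or.inl ⟨c, hc, hi, ht, hw⟩
    · have : t = k := by
        by_contra htk
        exact ht (hl t hit.symm hjt.symm htk)
      subst this
      exact Or.inr ⟨c, hc, hi, hj, ht, hl⟩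
  obtain ⟨j, hj⟩ := hex {i, t} (Finset.card_le_two.trans (by norm_num))
  obtain ⟨l, hl⟩ := hex {i, j, t} Finset.card_le_three
  simp only [Finset.mem_insert, Finset.mem_singleton, not_or] at hj hl
  obtain h | ⟨c, hc, -, hcj, hct, hc0⟩ := key j hj.1 hj.2
  · exact h
  obtain h | ⟨e, he, -, hel, het, he0⟩ := key l hl.1 hl.2.2
  · exact h
  have hej : e j = 0 := he0 j hj.1 (Ne.symm hl.2.1) hj.2
  have hmem : e t • c - c t • e ∈ C := sub_mem (C.smul_mem _ hc) (C.smul_mem _ he)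
  have hne : e t • c - c t • e ≠ 0 := by
    intro h
    have := congrFun h j
    simp [hej, hcj, het] at this
  have hsupp : ∀ p, p ≠ i → p ≠ j → p ≠ l → (e t • c - c t • e) p = 0 := by
    intro p hi hj hl
    by_cases hp : p = t
    · subst hp
      simp [mul_comm]
    · simp [hc0 p hi hj hp, he0 p hi hl hp]
  refine ⟨_, hmem, fun hi => ?_, by simp [mul_comm],
    (wt_le_card_of_forall_notMem {i, j, l} fun p h => ?_).trans Finset.card_le_three⟩
  · have h2 : wt (e t • c - c t • e) ≤ _ := wt_le_card_of_forall_notMem {j, l} fun p h => by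
      simp only [Finset.mem_insert, Finset.mem_singleton, not_or] at h
      by_cases hp : p = i
      · rwa [hp]
      · exact hsupp p hp h.1 h.2
    have := hd _ hmem hne
    have := Finset.card_le_two (a := j) (b := l)
    omega
  · simp only [Finset.mem_insert, Finset.mem_singleton, not_or] at h
    exact hsupp p h.1 h.2.1 h.2.2

end Geometry

section Shortening

variable {F : Type*} [Field F] {n : ℕ} {C : Submodule F (Fin (n + 1) → F)} {t : Fin (n + 1)} {d : ℕ}

theorem isCoveredByMinWeight_shortenedCode (hd : ∀ c ∈ C, c ≠ 0 → d ≤ wt c)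
    (h : ∀ i, i ≠ t → ∃ c ∈ C, c i ≠ 0 ∧ c t = 0 ∧ wt c ≤ d) :
    IsCoveredByMinWeight (shortenedCode C t) d := by
  classical
  constructor
  · rintro y ⟨c, hc, hct, hy⟩ hy0
    obtain rfl : y = fun i => c (t.succAbove i) := funext hy
    have := hd c hc (by rintro rfl; exact hy0 rfl)
    rwa [wt_comp_succAbove t, hct, if_neg (by simp), zero_add] at this
  · intro i
    obtain ⟨c, hc, hci, hct, hw⟩ := h (t.succAbove i) (Fin.succAbove_ne t i)
    refine ⟨fun i => c (t.succAbove i), ⟨c, hc, hct, fun _ => rfl⟩, hci, ?_⟩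
    rwa [wt_comp_succAbove t, hct, if_neg (by simp), zero_add] at hw

theorem isCoveredByMinWeight_dualCode_shortenedCode
    (hd : ∀ c ∈ dualCode C, c ≠ 0 → d + 1 ≤ wt c)
    (h : ∀ i, i ≠ t → ∃ c ∈ dualCode C, c i ≠ 0 ∧ c t ≠ 0 ∧ wt c ≤ d + 1) :
    IsCoveredByMinWeight (dualCode (shortenedCode C t)) d := by
  classical
  constructor
  · intro y hy hy0
    obtain ⟨c, hc, rfl⟩ := mem_dualCode_shortenedCode.1 hy
    have := hd c hc (by rintro rfl; exact hy0 rfl)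
    rw [wt_comp_succAbove t] at this
    split_ifs at this <;> omega
  · intro i
    obtain ⟨c, hc, hci, hct, hw⟩ := h (t.succAbove i) (Fin.succAbove_ne t i)
    refine ⟨fun i => c (t.succAbove i), mem_dualCode_shortenedCode.2 ⟨c, hc, rfl⟩, hci, ?_⟩
    rw [wt_comp_succAbove t, if_pos hct] at hw
    omega

end Shortening

/-- Shortening a `q`-ary Hamming code `C` of length `n + 1 = (q^m - 1)/(q-1)`
(and its dual, the Simplex code `S = C⊥`) at any coordinate `t` gives:
(i) an `[n, n+1-m-1, 3]` code with minimum linear locality `q^(m-1) - 2`;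
(ii) whose dual is an `[n, m, q^(m-1) - 1]` code with minimum linear locality `2`;
(iii) `S_t` is an `[n, m-1, q^(m-1)]` code with minimum linear locality `1`;
(iv) whose dual is an `[n, n+1-m, 2]` code with minimum linear locality `q^(m-1) - 1`. -/
theorem statement9 {F : Type*} [Field F] [Fintype F] (q m n : ℕ)
    (hq : Fintype.card F = q) (hm : 2 ≤ m) (hn : (n + 1) * (q - 1) = q ^ m - 1)
    (hn4 : 4 ≤ n + 1)
    (C : Submodule F (Fin (n + 1) → F))
    (hdim : Module.finrank F C = n + 1 - m) (hd : minDist C = 3)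
    (t : Fin (n + 1)) :
    (Module.finrank F (shortenedCode C t) = n - m ∧
      minDist (shortenedCode C t) = 3 ∧
      IsLeast {r : ℕ | HasLinearLocality (shortenedCode C t) r} (q ^ (m - 1) - 2)) ∧
    (Module.finrank F (dualCode (shortenedCode C t)) = m ∧
      minDist (dualCode (shortenedCode C t)) = q ^ (m - 1) - 1 ∧
      IsLeast {r : ℕ | HasLinearLocality (dualCode (shortenedCode C t)) r} 2) ∧
    (Module.finrank F (shortenedCode (dualCode C) t) = m - 1 ∧
      minDist (shortenedCode (dualCode C) t) = q ^ (m - 1) ∧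
      IsLeast {r : ℕ | HasLinearLocality (shortenedCode (dualCode C) t) r} 1) ∧
    (Module.finrank F (dualCode (shortenedCode (dualCode C) t)) = n + 1 - m ∧
      minDist (dualCode (shortenedCode (dualCode C) t)) = 2 ∧
      IsLeast {r : ℕ | HasLinearLocality (dualCode (shortenedCode (dualCode C) t)) r}
        (q ^ (m - 1) - 1)) := by
  have hq2 : 2 ≤ q := hq ▸ Fintype.one_lt_card
  have hmn : m ≤ n + 1 := by
    obtain ⟨k, rfl⟩ : ∃ k, q = k + 1 := ⟨q - 1, by omega⟩
    have h := one_add_mul_le_pow_of_sq_nonneg (R := ℕ) (a := k) (by positivity) (by positivity)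
      (by positivity) m
    rw [add_comm 1 k] at h
    rw [Nat.add_sub_cancel] at hn
    exact Nat.le_of_mul_le_mul_right (c := k) (by simp at h; omega) (by omega)
  have hq1 : 2 ≤ q ^ (m - 1) := hq2.trans (Nat.le_self_pow (by omega) q)
  have : Nontrivial (Fin (n + 1)) := Fin.nontrivial_iff_two_le.2 (by omega)
  have : Nonempty (Fin n) := ⟨⟨0, by omega⟩⟩
  have hw : ∀ c ∈ C, c ≠ 0 → 3 ≤ wt c := fun c => le_wt_of_minDist_eq hd
  have hW : Module.finrank F ((Fin (n + 1) → F) ⧸ C) = m := by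
    have := C.finrank_quotient_add_finrank
    rw [Module.finrank_fin_fun] at this
    omega
  have hn' : Fintype.card (Fin (n + 1)) * (q - 1) = q ^ m - 1 := by rwa [Fintype.card_fin]
  have hS : ∀ x ∈ dualCode C, x ≠ 0 → wt x = q ^ (m - 1) := fun x =>
    wt_of_mem_dualCode hw hq hW hn'
  have hne : ∀ {x : Fin (n + 1) → F} {i}, x i ≠ 0 → x ≠ 0 := by
    rintro x i h rfl
    exact h rfl
  have cov1 : IsCoveredByMinWeight (shortenedCode C t) (2 + 1) :=
    isCoveredByMinWeight_shortenedCode hw fun i hi =>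
      exists_light_word_avoiding hw hq hW hn' (by rwa [Fintype.card_fin]) hi
  have cov2 : IsCoveredByMinWeight (dualCode (shortenedCode C t)) (q ^ (m - 1) - 2 + 1) :=
    isCoveredByMinWeight_dualCode_shortenedCode
      (fun x hx h0 => by rw [hS x hx h0]; omega) fun i hi => by
        obtain ⟨x, hx, hxi, hxt⟩ := exists_dual_ne_zero_ne_zero hw hi
        exact ⟨x, hx, hxi, hxt, by rw [hS x hx (hne hxi)]; omega⟩
  have cov3 : IsCoveredByMinWeight (shortenedCode (dualCode C) t) (q ^ (m - 1) - 1 + 1) :=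
    isCoveredByMinWeight_shortenedCode
      (fun x hx h0 => by rw [hS x hx h0]; omega) fun i hi => by
        obtain ⟨x, hx, hxi, hxt⟩ := exists_dual_eq_zero_ne_zero hw hi
        exact ⟨x, hx, hxi, hxt, by rw [hS x hx (hne hxi)]; omega⟩
  have cov4 : IsCoveredByMinWeight (dualCode (shortenedCode (dualCode C) t)) (1 + 1) :=
    isCoveredByMinWeight_dualCode_shortenedCode (by rwa [dualCode_dualCode]) fun i hi => by
      rw [dualCode_dualCode]
      exact exists_light_word_through hw hq hW hn' hi
  obtain ⟨i, hi⟩ := exists_ne t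
  have dim1 := finrank_shortenedCode_add_one (C := C) (t := t) <| by
    obtain ⟨c, hc, -, hct, -⟩ := exists_light_word_through hw hq hW hn' hi
    exact ⟨c, hc, hct⟩
  have dim2 := finrank_dualCode (shortenedCode C t)
  have dim3 := finrank_shortenedCode_add_one (C := dualCode C) (t := t) <| by
    obtain ⟨x, hx, -, hxt⟩ := exists_dual_ne_zero_ne_zero hw hi
    exact ⟨x, hx, hxt⟩
  have dim4 := finrank_dualCode (shortenedCode (dualCode C) t)
  rw [finrank_dualCode, Fintype.card_fin] at dim3
  rw [Fintype.card_fin] at dim2 dim4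
  have loc1 := cov2.isLeast_locality_dualCode
  have loc3 := cov4.isLeast_locality_dualCode
  rw [dualCode_dualCode] at loc1 loc3
  refine ⟨⟨by omega, cov1.minDist_eq, loc1⟩,
    ⟨by omega, cov2.minDist_eq.trans (by omega), cov1.isLeast_locality_dualCode⟩,
    ⟨by omega, cov3.minDist_eq.trans (by omega), loc3⟩,
    ⟨by omega, cov4.minDist_eq, cov3.isLeast_locality_dualCode⟩⟩
end

section
/- Let q be a prime power, m ≥ 1 an integer, and let ℓ be an integer with 0 ≤ ℓ ≤ m(q − 1) − 1. Write m(q − 1) − 1 − ℓ = ℓ′₁(q − 1) + ℓ′₀ with 0 ≤ ℓ′₀ < q − 1. Then the generalized Reed–Muller code R_q(ℓ, m) has minimum linear locality (q − ℓ′₀)·q^{m − ℓ′₁ − 1} − 1. -/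
open scoped BigOperators

variable {F : Type*} [Field F] {ι : Type*} [Fintype ι]

/-- The generalized Reed–Muller code `R_q(ℓ, m)`: evaluation vectors, at all points of
`GF(q)^m`, of `m`-variate polynomials of total degree at most `ℓ`. -/
def GRM (F : Type*) [Field F] (ℓ m : ℕ) : Submodule F ((Fin m → F) → F) where
  carrier :=
    {g | ∃ p : MvPolynomial (Fin m) F, p.totalDegree ≤ ℓ ∧ ∀ x, g x = MvPolynomial.eval x p}
  add_mem' := by
    rintro g h ⟨p, hp, hgp⟩ ⟨p', hp', hhp'⟩
    exact ⟨p + p', le_trans (MvPolynomial.totalDegree_add p p') (max_le hp hp'),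
      fun x => by simp [hgp x, hhp' x]⟩
  zero_mem' := ⟨0, by simp, fun x => by simp⟩
  smul_mem' := by
    rintro r g ⟨p, hp, hgp⟩
    exact ⟨r • p, le_trans (MvPolynomial.totalDegree_smul_le r p) hp,
      fun x => by simp [hgp x, MvPolynomial.smul_eval]⟩

section GeneralizedReedMuller

open MvPolynomial Finset

theorem totalDegree_prod_X_sub_C_le {K σ : Type*} [Field K] (i : σ) (T : Finset K) :
    (∏ t ∈ T, (X i - C t : MvPolynomial σ K)).totalDegree ≤ #T := by
  refine (totalDegree_finsetProd _ _).trans ?_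
  rw [card_eq_sum_ones]
  refine sum_le_sum fun t _ => (totalDegree_sub_C_le _ _).trans ?_
  rw [totalDegree_X]

/-- A polynomial whose non-vanishing locus is the box `∏ i, s i`. -/
noncomputable def boxPolynomial {K σ : Type*} [Field K] [Fintype K] [DecidableEq K] [Fintype σ]
    (s : σ → Finset K) : MvPolynomial σ K :=
  ∏ i, ∏ t ∈ (s i)ᶜ, (X i - C t)

theorem totalDegree_boxPolynomial_le {K σ : Type*} [Field K] [Fintype K] [DecidableEq K]
    [Fintype σ] (s : σ → Finset K) : (boxPolynomial s).totalDegree ≤ ∑ i, #(s i)ᶜ :=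
  (totalDegree_finsetProd _ _).trans
    (sum_le_sum fun i _ => totalDegree_prod_X_sub_C_le i (s i)ᶜ)

theorem eval_boxPolynomial_ne_zero_iff {K σ : Type*} [Field K] [Fintype K] [DecidableEq K]
    [Fintype σ] [DecidableEq σ] (s : σ → Finset K) (x : σ → K) :
    eval x (boxPolynomial s) ≠ 0 ↔ x ∈ Fintype.piFinset s := by
  simp only [boxPolynomial, eval_prod, map_sub, eval_X, eval_C, prod_ne_zero_iff, mem_univ,
    true_imp_iff, sub_ne_zero, mem_compl, Fintype.mem_piFinset]
  refine forall_congr' fun i => ⟨fun h => ?_, fun h t ht hx => ht (hx ▸ h)⟩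
  by_contra hi
  exact h _ hi rfl

/-- The sets cut out by fixing the first `l` coordinates to those of `a` and excluding `B` from
the next one. -/
def flagBox {K : Type*} [Fintype K] [DecidableEq K] {m : ℕ} (l : ℕ) (a : Fin m → K)
    (B : Finset K) (i : Fin m) : Finset K :=
  if (i : ℕ) < l then {a i} else if (i : ℕ) = l then Bᶜ else univ

theorem prod_card_flagBox {K : Type*} [Fintype K] [DecidableEq K] {m : ℕ} {l : ℕ} (hl : l < m)
    (a : Fin m → K) (B : Finset K) :
    ∏ i, #(flagBox l a B i) = (Fintype.card K - #B) * Fintype.card K ^ (m - l - 1) := by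
  obtain ⟨r, rfl⟩ := Nat.exists_eq_add_of_le (Nat.succ_le_of_lt hl)
  have h : ∀ i : Fin (l.succ + r), #(flagBox l a B i) =
      (fun j : ℕ => if j < l then 1 else if j = l then Fintype.card K - #B
        else Fintype.card K) i := by
    intro i
    simp only [flagBox]
    split_ifs <;> simp [card_compl]
  rw [Fintype.prod_congr _ _ h, Fin.prod_univ_eq_prod_range (fun j : ℕ => if j < l then 1 else
      if j = l then Fintype.card K - #B else Fintype.card K), prod_range_add, prod_range_succ,
    prod_congr rfl (g := fun _ => 1) (fun j hj => if_pos (mem_range.1 hj)),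
    prod_congr rfl (s₁ := range r) (g := fun _ => Fintype.card K)
      (fun j _ => by rw [if_neg (by omega), if_neg (by omega)])]
  have : l.succ + r - l - 1 = r := by omega
  simp [this]

theorem sum_card_compl_flagBox {K : Type*} [Fintype K] [DecidableEq K] {m : ℕ} {l : ℕ}
    (hl : l < m) (a : Fin m → K) (B : Finset K) :
    ∑ i, #(flagBox l a B i)ᶜ = l * (Fintype.card K - 1) + #B := by
  obtain ⟨r, rfl⟩ := Nat.exists_eq_add_of_le (Nat.succ_le_of_lt hl)
  have h : ∀ i : Fin (l.succ + r), #(flagBox l a B i)ᶜ =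
      (fun j : ℕ => if j < l then Fintype.card K - 1 else if j = l then #B else 0) i := by
    intro i
    simp only [flagBox]
    split_ifs <;> simp [card_compl]
  rw [Fintype.sum_congr _ _ h, Fin.sum_univ_eq_sum_range (fun j : ℕ => if j < l then Fintype.card K - 1 else
      if j = l then #B else 0), sum_range_add, sum_range_succ,
    sum_congr rfl (g := fun _ => Fintype.card K - 1) (fun j hj => if_pos (mem_range.1 hj)),
    sum_congr rfl (s₁ := range r) (g := fun _ => 0)
      (fun j _ => by rw [if_neg (by omega), if_neg (by omega)])]
  simp

theorem sum_fin_succ_arrow {K M : Type*} [Fintype K] [AddCommMonoid M] {m : ℕ}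
    (f : (Fin (m + 1) → K) → M) :
    ∑ z, f z = ∑ t : K, ∑ y : Fin m → K, f (Fin.cons t y) := by
  rw [← Fintype.sum_prod_type' fun (t : K) (y : Fin m → K) => f (Fin.cons t y)]
  exact (Fintype.sum_equiv (Fin.consEquiv fun _ => K) _ _ fun _ => rfl).symm

/-- A nonzero word annihilating all polynomials of degree less than `a * (q - 1) + b` has weight
at least `(b + 1) * q ^ a`. -/
theorem le_card_support_of_sum_mul_eval_eq_zero {K : Type*} [Field K] [Fintype K]
    [DecidableEq K] (Q : ℕ) (hQ : Fintype.card K = Q + 1) {m : ℕ} (x : (Fin m → K) → K)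
    (a b : ℕ) (hb : b ≤ Q)
    (hx : ∀ p : MvPolynomial (Fin m) K, p.totalDegree < a * Q + b → ∑ z, x z * eval z p = 0)
    (hx0 : x ≠ 0) : (b + 1) * (Q + 1) ^ a ≤ #{z | x z ≠ 0} := by
  have hQ0 : 0 < Q := by
    have := Fintype.one_lt_card (α := K)
    omega
  induction m generalizing a b with
  | zero =>
    obtain ⟨z, hz⟩ := Function.ne_iff.1 hx0
    have hn : a * Q + b = 0 := by
      by_contra hn
      have h := hx 1 (by rw [totalDegree_one]; omega)
      rw [Fintype.sum_subsingleton _ z] at h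
      simp at h
      exact hz h
    obtain ⟨ha, rfl⟩ := Nat.add_eq_zero_iff.1 hn
    obtain rfl : a = 0 := (Nat.mul_eq_zero.1 ha).resolve_right hQ0.ne'
    simpa only [zero_add, pow_zero, mul_one] using
      Nat.succ_le_of_lt (card_pos.2 ⟨z, mem_filter.2 ⟨mem_univ z, hz⟩⟩)
  | succ m ih =>
    set A : Finset K := {t | (fun y : Fin m → K => x (Fin.cons t y)) ≠ 0} with hA
    have hA_not : ∀ t ∉ A, ∀ y, x (Fin.cons t y) = 0 := by
      intro t ht y
      simp only [hA, mem_filter, mem_univ, true_and, not_not] at ht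
      exact congrFun ht y
    have hApos : 0 < #A := by
      obtain ⟨z, hz⟩ := Function.ne_iff.1 hx0
      refine card_pos.2 ⟨z 0, ?_⟩
      by_contra h
      exact hz (by simpa using hA_not _ h (Fin.tail z))
    obtain ⟨j, hj⟩ : ∃ j, #A = j + 1 := ⟨#A - 1, by omega⟩
    have hjQ : j ≤ Q := by
      have := card_le_univ A
      omega
    have slice_annihilates : ∀ t₀ ∈ A, ∀ p : MvPolynomial (Fin m) K,
        p.totalDegree < a * Q + b - j → ∑ y, x (Fin.cons t₀ y) * eval y p = 0 := by
      intro t₀ ht₀ p hp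
      have hcard : #(A.erase t₀) = j := by rw [card_erase_of_mem ht₀, hj]; omega
      have h := hx ((∏ t ∈ A.erase t₀, (X 0 - C t)) * rename Fin.succ p) <| by
        have h1 := totalDegree_mul (∏ t ∈ A.erase t₀, (X 0 - C t : MvPolynomial (Fin (m + 1)) K))
          (rename Fin.succ p)
        have h2 := totalDegree_prod_X_sub_C_le (0 : Fin (m + 1)) (A.erase t₀)
        have h3 := totalDegree_rename_le (Fin.succ : Fin m → Fin (m + 1)) p
        omega
      rw [sum_fin_succ_arrow, Fintype.sum_eq_single t₀] at h
      · simp only [map_mul, eval_prod, map_sub, eval_X, eval_C, eval_rename, Fin.cons_zero] at h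
        have hc : ∀ y : Fin m → K, (Fin.cons t₀ y : Fin (m + 1) → K) ∘ Fin.succ = y :=
          fun y => funext fun i => by simp
        simp only [hc, mul_left_comm (x _), ← mul_sum] at h
        refine (mul_eq_zero.1 h).resolve_left (prod_ne_zero_iff.2 fun t ht => ?_)
        exact sub_ne_zero.2 (ne_of_mem_erase ht).symm
      · intro t ht
        refine sum_eq_zero fun y _ => ?_
        by_cases htA : t ∈ A
        · rw [map_mul, eval_prod, prod_eq_zero (mem_erase.2 ⟨ht, htA⟩) (by simp)]
          simp
        · rw [hA_not t htA, zero_mul]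
    have weight_ge : ∀ a' b', b' ≤ Q → a' * Q + b' ≤ a * Q + b - j →
        (j + 1) * ((b' + 1) * (Q + 1) ^ a') ≤ #{z | x z ≠ 0} := by
      intro a' b' hb' hle
      rw [card_filter, sum_fin_succ_arrow, ← hj, ← smul_eq_mul]
      refine le_trans ?_ (sum_le_univ_sum_of_nonneg (s := A) fun _ => Nat.zero_le _)
      refine card_nsmul_le_sum _ _ _ fun t ht => ?_
      rw [← card_filter]
      exact ih _ a' b' hb' (fun p hp => slice_annihilates t ht p (hp.trans_le hle))
        (by simpa [hA] using ht)
    rcases le_or_gt j b with hjb | hjb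
    · obtain ⟨e, rfl⟩ := Nat.exists_eq_add_of_le hjb
      refine le_trans ?_ (weight_ge a e (by omega) (by omega))
      rw [← mul_assoc]
      exact Nat.mul_le_mul_right _ (by nlinarith [Nat.zero_le (j * e)])
    · obtain ⟨e, rfl⟩ := Nat.exists_eq_add_of_le hjb.le
      obtain ⟨f, rfl⟩ := Nat.exists_eq_add_of_le hjQ
      cases a with
      | zero =>
        refine le_trans ?_ (weight_ge 0 0 (by omega) (by omega))
        simp
      | succ a =>
        refine le_trans ?_ (weight_ge a (b + f) (by omega) ?_)
        · rw [pow_succ', ← mul_assoc, ← mul_assoc]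
          exact Nat.mul_le_mul_right _ (by nlinarith [Nat.zero_le (e * f)])
        · rw [Nat.succ_mul]
          omega

end GeneralizedReedMuller

/-- Write `m(q-1) - 1 - ℓ = l1(q-1) + l0` with `0 ≤ l0 < q - 1`. Then the
generalized Reed–Muller code `R_q(ℓ, m)` has minimum linear locality
`(q - l0) * q^(m - l1 - 1) - 1`. -/
theorem statement10 {F : Type*} [Field F] [Fintype F] (q m ℓ l1 l0 : ℕ)
    (hq : Fintype.card F = q) (hm : 1 ≤ m) (hℓ : ℓ ≤ m * (q - 1) - 1)
    (hdecomp : m * (q - 1) - 1 - ℓ = l1 * (q - 1) + l0) (hl0 : l0 < q - 1) :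
    IsLeast {r : ℕ | HasLinearLocality (GRM F ℓ m) r} ((q - l0) * q ^ (m - l1 - 1) - 1) := by
  classical
  obtain ⟨Q, rfl⟩ : ∃ Q, q = Q + 1 := ⟨q - 1, by omega⟩
  simp only [Nat.add_sub_cancel] at *
  have hmQ : 0 < m * Q := Nat.mul_pos (by omega) (by omega)
  have hl1 : l1 < m := by
    by_contra h
    have := Nat.mul_le_mul_right Q (not_lt.1 h)
    omega
  constructor
  · intro a
    obtain ⟨B, hB, hBcard⟩ : ∃ B ⊆ Finset.univ.erase (a ⟨l1, hl1⟩), B.card = l0 :=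
      Finset.exists_subset_card_eq (by
        rw [Finset.card_erase_of_mem (Finset.mem_univ _), Finset.card_univ]
        omega)
    set s := flagBox l1 a B with hs
    have ha : a ∈ Fintype.piFinset s := by
      rw [Fintype.mem_piFinset]
      intro i
      simp only [hs, flagBox]
      split_ifs with h1 h2
      · simp
      · obtain rfl : i = ⟨l1, hl1⟩ := Fin.ext h2
        exact Finset.mem_compl.2 fun h => Finset.ne_of_mem_erase (hB h) rfl
      · simp
    have hne := (eval_boxPolynomial_ne_zero_iff s a).2 ha
    set P := boxPolynomial s
    refine ⟨(Fintype.piFinset s).erase a,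
      fun z => -(MvPolynomial.eval a P)⁻¹ * MvPolynomial.eval z P, by simp, ?_, ?_⟩
    · rw [Finset.card_erase_of_mem ha, Fintype.card_piFinset, hs, prod_card_flagBox hl1, hBcard, hq]
    · rintro c ⟨p, hp, hc⟩
      have hsum : ∑ z, MvPolynomial.eval z (P * p) = 0 := by
        apply MvPolynomial.sum_eval_eq_zero
        have h1 := MvPolynomial.totalDegree_mul P p
        have h2 := totalDegree_boxPolynomial_le s
        rw [hs, sum_card_compl_flagBox hl1, hBcard, hq, Nat.add_sub_cancel] at h2
        rw [Fintype.card_fin, hq, Nat.add_sub_cancel, mul_comm Q m]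
        change P.totalDegree ≤ _ at h2
        omega
      rw [← Finset.sum_subset (Finset.subset_univ (Fintype.piFinset s)),
        ← Finset.add_sum_erase _ _ ha] at hsum
      · simp only [map_mul, ← hc] at hsum
        simp only [mul_assoc, ← Finset.mul_sum]
        rw [eq_neg_of_add_eq_zero_right hsum]
        field_simp
      · intro z _ hz
        rw [map_mul, not_not.1 (mt (eval_boxPolynomial_ne_zero_iff s z).1 hz), zero_mul]
  · intro r hr
    obtain ⟨R, u, h0R, hRr, hu⟩ := hr 0
    let x : (Fin m → F) → F := fun z => (if z = 0 then 1 else 0) - if z ∈ R then u z else 0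
    have hx0 : x ≠ 0 := fun h => by simpa [x, h0R] using congrFun h 0
    obtain ⟨n, rfl⟩ := Nat.exists_eq_add_of_le (Nat.succ_le_of_lt hl1)
    have hdeg : n * Q + (Q - l0) = ℓ + 1 := by
      have : (l1.succ + n) * Q = l1 * Q + Q + n * Q := by rw [Nat.succ_eq_add_one]; ring
      omega
    have hw := le_card_support_of_sum_mul_eval_eq_zero Q hq x n (Q - l0) (by omega)
      (fun p hp => by
        have h := hu (fun z => MvPolynomial.eval z p) ⟨p, by omega, fun _ => rfl⟩
        simp only [x, sub_mul, ite_mul, one_mul, zero_mul, Finset.sum_sub_distrib,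
          Finset.sum_ite_eq', Finset.mem_univ, if_true, Finset.sum_ite_mem, Finset.univ_inter]
        exact sub_eq_zero.2 h) hx0
    have hcard : (Finset.univ.filter fun z => x z ≠ 0).card ≤ R.card + 1 := by
      rw [← Finset.card_insert_of_notMem h0R]
      refine Finset.card_le_card fun z hz => ?_
      by_contra hz'
      rw [Finset.mem_insert, not_or] at hz'
      simp [x, hz'.1, hz'.2] at hz
    have e1 : l1.succ + n - l1 - 1 = n := by omega
    have e2 : Q + 1 - l0 = Q - l0 + 1 := by omega
    rw [e1, e2]
    omega
end
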